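/- arXiv:2204.02485 — 10 statements merged into one kernel-verified Lean document; each statement's English description precedes it below -/
import Mathlib

section
/- Let K ≥ 1 and let σ₁ : ℝ^K → ℝ^K denote the softmax map, σ₁(z)_k = exp(z_k)/∑_{j=1}^K exp(z_j), and let σ₂ : ℝ^K → ℝ^K denote linear normalization, σ₂(v)_k = v_k/∑_{j=1}^K v_j. For any z_A, z_B ∈ ℝ^K and any freq ∈ ℝ^K with strictly positive entries, σ₂( (σ₁(z_A) ⊙ σ₁(z_B)) / freq ) = σ₁( z_A + z_B − ln freq ), where ⊙ denotes the element-wise product and the division and logarithm are taken element-wise. -/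
/-- Softmax: `σ₁(z)_k = exp(z_k) / ∑_j exp(z_j)`. -/
noncomputable def softmax {K : ℕ} (z : Fin K → ℝ) : Fin K → ℝ :=
  fun k => Real.exp (z k) / ∑ j, Real.exp (z j)

/-- Linear normalization: `σ₂(v)_k = v_k / ∑_j v_j`. -/
noncomputable def linNorm {K : ℕ} (v : Fin K → ℝ) : Fin K → ℝ :=
  fun k => v k / ∑ j, v j

/-- Linear normalization is invariant under scaling by a nonzero constant. -/
theorem linNorm_const_mul {K : ℕ} {c : ℝ} (hc : c ≠ 0) (v : Fin K → ℝ) :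
    linNorm (fun k => c * v k) = linNorm v := by
  funext k
  simp only [linNorm, ← Finset.mul_sum]
  exact mul_div_mul_left _ _ hc

theorem sum_exp_pos {K : ℕ} (hK : 1 ≤ K) (z : Fin K → ℝ) : 0 < ∑ j, Real.exp (z j) :=
  Finset.sum_pos (fun j _ => Real.exp_pos (z j)) ⟨⟨0, hK⟩, Finset.mem_univ _⟩

/-- Statistical fusion equals softmax of summed logits shifted by `ln freq`. -/
theorem stat_fusion_eq_softmax (K : ℕ) (hK : 1 ≤ K)
    (zA zB freq : Fin K → ℝ) (hfreq : ∀ k, 0 < freq k) :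
    linNorm (fun k => softmax zA k * softmax zB k / freq k) =
      softmax (fun k => zA k + zB k - Real.log (freq k)) := by
  have hA := (sum_exp_pos hK zA).ne'
  have hB := (sum_exp_pos hK zB).ne'
  have hscale : (fun k => softmax zA k * softmax zB k / freq k) =
      fun k => ((∑ j, Real.exp (zA j)) * ∑ j, Real.exp (zB j))⁻¹ *
        Real.exp (zA k + zB k - Real.log (freq k)) := by
    funext k
    have hk := (hfreq k).ne'
    rw [Real.exp_sub, Real.exp_add, Real.exp_log (hfreq k)]
    simp only [softmax]
    field_simp
  rw [hscale, linNorm_const_mul (inv_ne_zero (mul_ne_zero hA hB))]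
  rfl
end

section
/- Let K, H ≥ 1, γ ∈ (0,1), κ = 1/γ − 1. Let J ∈ ℝ^{K×K} be symmetric, W_A ∈ ℝ^{K×H}, and suppose W_a ∈ ℝ^{K×K} satisfies the Sylvester-type equation κ J² W_a (W_A W_Aᵀ) + W_a = I. Then ‖J W_a W_A‖_F² = (γ/(1−γ)) · ( Tr(W_a) − Tr(W_a W_aᵀ) ), where ‖M‖_F denotes the Frobenius norm of the matrix M. -/
open Matrix

/-- Squared Frobenius norm of a real matrix. -/
def frobSq {m n : Type*} [Fintype m] [Fintype n] (M : Matrix m n ℝ) : ℝ :=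
  ∑ i, ∑ j, (M i j) ^ 2

theorem frobSq_eq_trace_mul_transpose {m n : Type*} [Fintype m] [Fintype n]
    (M : Matrix m n ℝ) : frobSq M = (M * Mᵀ).trace := by
  simp [frobSq, Matrix.trace, Matrix.mul_apply, sq]

theorem frob_eq_trace_form (K H : ℕ) (hK : 1 ≤ K) (hH : 1 ≤ H)
    (γ : ℝ) (hγ0 : 0 < γ) (hγ1 : γ < 1) (κ : ℝ) (hκ : κ = 1 / γ - 1)
    (J : Matrix (Fin K) (Fin K) ℝ) (hJ : J.IsSymm)
    (WA : Matrix (Fin K) (Fin H) ℝ) (Wa : Matrix (Fin K) (Fin K) ℝ)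
    (heq : κ • (J * J * Wa * (WA * WAᵀ)) + Wa = 1) :
    frobSq (J * Wa * WA) =
      (γ / (1 - γ)) * (Wa.trace - (Wa * Waᵀ).trace) := by
  have hfrob : frobSq (J * Wa * WA) = (J * J * Wa * (WA * WAᵀ) * Waᵀ).trace := by
    rw [frobSq_eq_trace_mul_transpose, transpose_mul, transpose_mul, hJ.eq,
      ← Matrix.mul_assoc, ← Matrix.mul_assoc, trace_mul_comm]
    simp only [Matrix.mul_assoc]
  have htrace := congrArg (fun M => (M * Waᵀ).trace) heq
  simp only [Matrix.add_mul, Matrix.smul_mul, trace_add, trace_smul, smul_eq_mul,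
    Matrix.one_mul, trace_transpose, ← hfrob] at htrace
  have hγ : 1 - γ ≠ 0 := by linarith
  rw [← htrace, hκ]
  field_simp
  ring
end

section
/- Let K, H ≥ 1, γ ∈ (0,1), κ = 1/γ − 1. Let J ∈ ℝ^{K×K} be symmetric, W_A ∈ ℝ^{K×H}, and suppose W_a ∈ ℝ^{K×K} satisfies κ J² W_a (W_A W_Aᵀ) + W_a = I. Then (1−γ)·‖J W_a W_A‖_F² + (γ/2)·‖W_a − I‖_F² = (γ/2)·( K − Tr(W_a W_aᵀ) ). -/
open Matrix

theorem loss_value_at_optimum (K H : ℕ) (hK : 1 ≤ K) (hH : 1 ≤ H)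
    (γ : ℝ) (hγ0 : 0 < γ) (hγ1 : γ < 1) (κ : ℝ) (hκ : κ = 1 / γ - 1)
    (J : Matrix (Fin K) (Fin K) ℝ) (hJ : J.IsSymm)
    (WA : Matrix (Fin K) (Fin H) ℝ) (Wa : Matrix (Fin K) (Fin K) ℝ)
    (heq : κ • (J * J * Wa * (WA * WAᵀ)) + Wa = 1) :
    (1 - γ) * frobSq (J * Wa * WA) + (γ / 2) * frobSq (Wa - 1) =
      (γ / 2) * ((K : ℝ) - (Wa * Waᵀ).trace) := by
  have hγκ : 1 - γ = γ * κ := by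
    rw [hκ]
    field_simp
  have hJac : κ * frobSq (J * Wa * WA) = Wa.trace - (Wa * Waᵀ).trace := by
    have hcycle : frobSq (J * Wa * WA) = (J * J * Wa * (WA * WAᵀ) * Waᵀ).trace := by
      rw [frobSq_eq_trace_mul_transpose, transpose_mul, transpose_mul, hJ.eq,
        ← Matrix.mul_assoc, ← Matrix.mul_assoc, Matrix.trace_mul_comm]
      simp only [Matrix.mul_assoc]
    rw [hcycle, ← smul_eq_mul, ← trace_smul, ← Matrix.smul_mul, eq_sub_of_add_eq heq,
      Matrix.sub_mul, Matrix.one_mul, trace_sub, trace_transpose]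
  have hReg : frobSq (Wa - 1) = (Wa * Waᵀ).trace - 2 * Wa.trace + K := by
    rw [frobSq_eq_trace_mul_transpose, transpose_sub, transpose_one, Matrix.sub_mul,
      Matrix.mul_sub, Matrix.mul_one, Matrix.one_mul]
    simp only [trace_sub, trace_transpose, trace_one, Fintype.card_fin]
    ring
  rw [hγκ, hReg]
  linear_combination γ * hJac
end

section
/- Let K, H ≥ 1, γ ∈ (0,1), κ = 1/γ − 1. Let J ∈ ℝ^{K×K} be symmetric, W_A ∈ ℝ^{K×H}, and suppose W_a ∈ ℝ^{K×K} satisfies κ J² W_a (W_A W_Aᵀ) + W_a = I. Then ‖J W_a W_A‖_F² ≤ γK / (2(1−γ)); equivalently ‖J W_a W_A‖_F ≤ √(γK/(2(1−γ))). -/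
open Matrix

theorem frobSq_eq_trace {m n : Type*} [Fintype m] [Fintype n] (M : Matrix m n ℝ) :
    frobSq M = (Mᵀ * M).trace := by
  simp only [frobSq, trace, diag_apply, mul_apply, transpose_apply, ← pow_two]
  exact Finset.sum_comm

/-- Entrywise form of `x - x ^ 2 ≤ 1 / 4`, summed over the diagonal. -/
theorem trace_sub_frobSq_le {n : Type*} [Fintype n] (M : Matrix n n ℝ) :
    M.trace - frobSq M ≤ Fintype.card n / 4 := by
  have hdiag : ∑ i, (M i i) ^ 2 ≤ frobSq M :=
    Finset.sum_le_sum fun i _ =>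
      Finset.single_le_sum (f := fun j => (M i j) ^ 2) (fun j _ => sq_nonneg _) (Finset.mem_univ i)
  have hquarter : ∑ i, (M i i - (M i i) ^ 2) ≤ ∑ _i : n, (1 / 4 : ℝ) :=
    Finset.sum_le_sum fun i _ => by nlinarith [sq_nonneg (M i i - 1 / 2)]
  rw [Finset.sum_sub_distrib, Finset.sum_const, Finset.card_univ, nsmul_eq_mul] at hquarter
  simp only [trace, diag_apply]
  linarith

/-- Pairing the optimality condition with `W` in the trace inner product. -/
theorem mul_frobSq_eq_trace_sub_frobSq {m n : Type*} [Fintype m] [Fintype n] [DecidableEq m]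
    {c : ℝ} {J W : Matrix m m ℝ} {A : Matrix m n ℝ} (hJ : J.IsSymm)
    (h : c • (J * J * W * (A * Aᵀ)) + W = 1) :
    c * frobSq (J * W * A) = W.trace - frobSq W := by
  have hW : c • (J * J * W * (A * Aᵀ)) = 1 - W := eq_sub_of_add_eq h
  have hcyc : ((J * W * A)ᵀ * (J * W * A)).trace = (Wᵀ * (J * J * W * (A * Aᵀ))).trace := by
    rw [transpose_mul, transpose_mul, hJ.eq, Matrix.mul_assoc, trace_mul_comm]
    simp only [Matrix.mul_assoc]
  rw [frobSq_eq_trace, hcyc, ← smul_eq_mul, ← trace_smul, ← Matrix.mul_smul, hW, Matrix.mul_sub,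
    Matrix.mul_one, trace_sub, trace_transpose, frobSq_eq_trace]

theorem frob_bound_at_optimum (K H : ℕ) (hK : 1 ≤ K) (hH : 1 ≤ H)
    (γ : ℝ) (hγ0 : 0 < γ) (hγ1 : γ < 1) (κ : ℝ) (hκ : κ = 1 / γ - 1)
    (J : Matrix (Fin K) (Fin K) ℝ) (hJ : J.IsSymm)
    (WA : Matrix (Fin K) (Fin H) ℝ) (Wa : Matrix (Fin K) (Fin K) ℝ)
    (heq : κ • (J * J * Wa * (WA * WAᵀ)) + Wa = 1) :
    frobSq (J * Wa * WA) ≤ γ * K / (2 * (1 - γ)) ∧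
      Real.sqrt (frobSq (J * Wa * WA)) ≤ Real.sqrt (γ * K / (2 * (1 - γ))) := by
  have hbound : frobSq (J * Wa * WA) ≤ γ * K / (2 * (1 - γ)) := by
    have hquarter := trace_sub_frobSq_le Wa
    rw [← mul_frobSq_eq_trace_sub_frobSq hJ heq, Fintype.card_fin] at hquarter
    have hγκ : γ * κ = 1 - γ := by
      rw [hκ]
      field_simp
    have hscaled := mul_le_mul_of_nonneg_left hquarter hγ0.le
    rw [← mul_assoc, hγκ] at hscaled
    have hγK : 0 ≤ γ * K := by positivity
    rw [le_div_iff₀ (by linarith)]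
    linarith
  exact ⟨hbound, Real.sqrt_le_sqrt hbound⟩
end

section
/- (Theorem 1, rigorous linearized form.) Let K, H, d ≥ 1, γ ∈ (0,1), κ = 1/γ − 1. Let J ∈ ℝ^{K×K} be symmetric, W_A ∈ ℝ^{K×H}, and suppose W_a ∈ ℝ^{K×K} satisfies κ J² W_a (W_A W_Aᵀ) + W_a = I. Let f_A : ℝ^d → ℝ^H be l-Lipschitz (with respect to Euclidean norms). Then for every x_A ∈ ℝ^d and every perturbation ε ∈ ℝ^d, the first-order change of the fused prediction satisfies ‖ J W_a W_A ( f_A(x_A + ε) − f_A(x_A) ) ‖₂ ≤ l · √(γK/(2(1−γ))) · ‖ε‖₂. -/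
open Matrix

/-- Euclidean norm of a real vector. -/
noncomputable def euclNorm {n : Type*} [Fintype n] (v : n → ℝ) : ℝ :=
  Real.sqrt (∑ i, (v i) ^ 2)

/-- The squared Frobenius norm of a real matrix is the trace of its Gram matrix. -/
lemma trace_transpose_mul_self_eq_sum_sq {m n : Type*} [Fintype m] [Fintype n]
    (M : Matrix m n ℝ) : (Mᵀ * M).trace = ∑ i, ∑ j, M i j ^ 2 := by
  rw [Finset.sum_comm]
  simp [Matrix.trace, Matrix.mul_apply, pow_two]

/-- The Euclidean operator norm is at most the Frobenius norm. -/
lemma euclNorm_mulVec_le {m n : Type*} [Fintype m] [Fintype n]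
    (M : Matrix m n ℝ) (v : n → ℝ) :
    euclNorm (M *ᵥ v) ≤ √(∑ i, ∑ j, M i j ^ 2) * euclNorm v := by
  unfold euclNorm
  rw [← Real.sqrt_mul (by positivity), Finset.sum_mul]
  refine Real.sqrt_le_sqrt (Finset.sum_le_sum fun i _ => ?_)
  exact Finset.sum_mul_sq_le_sq_mul_sq Finset.univ (M i) v

/-- The trace exceeds the squared Frobenius norm by at most a quarter of the dimension. -/
lemma trace_sub_sum_sq_le {n : Type*} [Fintype n] (W : Matrix n n ℝ) :
    W.trace - ∑ i, ∑ j, W i j ^ 2 ≤ Fintype.card n / 4 := by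
  have h : ∀ i, W i i - ∑ j, W i j ^ 2 ≤ 1 / 4 := fun i => by
    have := Finset.single_le_sum (f := fun j => W i j ^ 2) (fun j _ => sq_nonneg _)
      (Finset.mem_univ i)
    nlinarith [sq_nonneg (W i i - 1 / 2)]
  calc W.trace - ∑ i, ∑ j, W i j ^ 2 = ∑ i, (W i i - ∑ j, W i j ^ 2) := by
        simp [Matrix.trace]
    _ ≤ ∑ _i : n, (1 / 4 : ℝ) := Finset.sum_le_sum fun i _ => h i
    _ = Fintype.card n / 4 := by simp [div_eq_mul_inv]

/-- Pairing the optimality equation with its solution `W` controls the Frobenius norm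
of `J * W * A`. -/
lemma mul_sum_sq_add_sum_sq_eq_trace {m n : Type*} [Fintype m] [Fintype n] [DecidableEq m]
    {κ : ℝ} {J W : Matrix m m ℝ} {A : Matrix m n ℝ} (hJ : J.IsSymm)
    (h : κ • (J * J * W * (A * Aᵀ)) + W = 1) :
    κ * ∑ i, ∑ j, (J * W * A) i j ^ 2 + ∑ i, ∑ j, W i j ^ 2 = W.trace := by
  rw [← trace_transpose_mul_self_eq_sum_sq, ← trace_transpose_mul_self_eq_sum_sq]
  have hM : ((J * W * A)ᵀ * (J * W * A)).trace = (Wᵀ * (J * J * W * (A * Aᵀ))).trace := by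
    rw [Matrix.transpose_mul, Matrix.transpose_mul, hJ.eq, Matrix.mul_assoc Aᵀ,
      Matrix.trace_mul_comm]
    simp only [Matrix.mul_assoc]
  have hT := congrArg (fun X => (Wᵀ * X).trace) h
  rw [hM]
  simpa [Matrix.mul_add] using hT

theorem linearized_prediction_change_bound (K H d : ℕ)
    (hK : 1 ≤ K) (hH : 1 ≤ H) (hd : 1 ≤ d)
    (γ : ℝ) (hγ0 : 0 < γ) (hγ1 : γ < 1) (κ : ℝ) (hκ : κ = 1 / γ - 1)
    (J : Matrix (Fin K) (Fin K) ℝ) (hJ : J.IsSymm)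
    (WA : Matrix (Fin K) (Fin H) ℝ) (Wa : Matrix (Fin K) (Fin K) ℝ)
    (heq : κ • (J * J * Wa * (WA * WAᵀ)) + Wa = 1)
    (l : ℝ) (fA : (Fin d → ℝ) → (Fin H → ℝ))
    (hLip : ∀ x y : Fin d → ℝ, euclNorm (fA x - fA y) ≤ l * euclNorm (x - y))
    (xA ε : Fin d → ℝ) :
    euclNorm ((J * Wa * WA).mulVec (fA (xA + ε) - fA xA)) ≤
      l * Real.sqrt (γ * K / (2 * (1 - γ))) * euclNorm ε := by
  have hκ0 : 0 < κ := by
    rw [hκ, sub_pos]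
    exact (one_lt_div hγ0).2 hγ1
  have hF : ∑ i, ∑ j, (J * Wa * WA) i j ^ 2 ≤ γ * K / (2 * (1 - γ)) := by
    have h₁ := mul_sum_sq_add_sum_sq_eq_trace hJ heq
    have h₂ := trace_sub_sum_sq_le Wa
    rw [Fintype.card_fin] at h₂
    have hc : γ * K / (2 * (1 - γ)) = K / 2 / κ := by
      have : 1 - γ ≠ 0 := (sub_pos.2 hγ1).ne'
      rw [hκ]
      field_simp
    rw [hc, le_div_iff₀ hκ0]
    have : (0 : ℝ) ≤ K := K.cast_nonneg
    linarith
  have hε := hLip (xA + ε) xA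
  rw [add_sub_cancel_left] at hε
  calc _ ≤ √(∑ i, ∑ j, (J * Wa * WA) i j ^ 2) * euclNorm (fA (xA + ε) - fA xA) :=
        euclNorm_mulVec_le _ _
    _ ≤ √(γ * K / (2 * (1 - γ))) * (l * euclNorm ε) :=
        mul_le_mul (Real.sqrt_le_sqrt hF) hε (Real.sqrt_nonneg _) (Real.sqrt_nonneg _)
    _ = _ := by ring
end

section
/- Let K, H ≥ 1, γ ∈ (0,1), κ = 1/γ − 1. Let J ∈ ℝ^{K×K} be symmetric and W_A ∈ ℝ^{K×H}. If W_a ∈ ℝ^{K×K} satisfies κ J² W_a (W_A W_Aᵀ) + W_a = I, then W_a is a global minimizer of the regularized Jacobian loss: for every W ∈ ℝ^{K×K}, (1−γ)‖J W_a W_A‖_F² + γ‖W_a − I‖_F² ≤ (1−γ)‖J W W_A‖_F² + γ‖W − I‖_F². -/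
open Matrix

theorem frobSq_nonneg {m n : Type*} [Fintype m] [Fintype n] (M : Matrix m n ℝ) :
    0 ≤ frobSq M :=
  Finset.sum_nonneg fun _ _ => Finset.sum_nonneg fun _ _ => sq_nonneg _

theorem frobSq_add {m n : Type*} [Fintype m] [Fintype n] (A B : Matrix m n ℝ) :
    frobSq (A + B) = frobSq A + 2 * (Aᵀ * B).trace + frobSq B := by
  have htrace : (Aᵀ * B).trace = ∑ i, ∑ j, A i j * B i j := by
    simp only [trace, diag_apply, mul_apply, transpose_apply]
    exact Finset.sum_comm
  rw [htrace]
  simp only [frobSq, Finset.mul_sum, ← Finset.sum_add_distrib, Matrix.add_apply]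
  refine Finset.sum_congr rfl fun i _ => Finset.sum_congr rfl fun j _ => ?_
  ring

theorem sylvester_solution_is_global_min (K H : ℕ) (hK : 1 ≤ K) (hH : 1 ≤ H)
    (γ : ℝ) (hγ0 : 0 < γ) (hγ1 : γ < 1) (κ : ℝ) (hκ : κ = 1 / γ - 1)
    (J : Matrix (Fin K) (Fin K) ℝ) (hJ : J.IsSymm)
    (WA : Matrix (Fin K) (Fin H) ℝ) (Wa : Matrix (Fin K) (Fin K) ℝ)
    (heq : κ • (J * J * Wa * (WA * WAᵀ)) + Wa = 1) :
    ∀ W : Matrix (Fin K) (Fin K) ℝ,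
      (1 - γ) * frobSq (J * Wa * WA) + γ * frobSq (Wa - 1) ≤
        (1 - γ) * frobSq (J * W * WA) + γ * frobSq (W - 1) := by
  intro W
  obtain ⟨D, rfl⟩ : ∃ D, W = Wa + D := ⟨W - Wa, by abel⟩
  have hγκ : γ * κ = 1 - γ := by
    rw [hκ]
    field_simp
  have hres : Wa - 1 = -(κ • (J * J * Wa * (WA * WAᵀ))) := by
    rw [← heq]
    abel
  have hcross : (1 - γ) * ((J * Wa * WA)ᵀ * (J * D * WA)).trace
      + γ * ((Wa - 1)ᵀ * D).trace = 0 := by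
    have hcycle : ((J * Wa * WA)ᵀ * (J * D * WA)).trace
        = ((J * J * Wa * (WA * WAᵀ))ᵀ * D).trace := by
      rw [← Matrix.mul_assoc, Matrix.trace_mul_comm]
      simp only [transpose_mul, transpose_transpose, hJ.eq, Matrix.mul_assoc]
    rw [hres, hcycle, transpose_neg, transpose_smul, Matrix.neg_mul, Matrix.smul_mul,
      trace_neg, trace_smul, smul_eq_mul, ← hγκ]
    ring
  have hJW : J * (Wa + D) * WA = J * Wa * WA + J * D * WA := by
    rw [Matrix.mul_add, Matrix.add_mul]
  have hW : Wa + D - 1 = (Wa - 1) + D := by abel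
  rw [hJW, hW, frobSq_add, frobSq_add]
  have hJD := mul_nonneg (sub_nonneg.2 hγ1.le) (frobSq_nonneg (J * D * WA))
  have hD := mul_nonneg hγ0.le (frobSq_nonneg D)
  linarith
end

section
/- Let κ, a, b, c ∈ ℝ and suppose D := 4(ac − b²)κ² + 2(a + c)κ + 1 ≠ 0. Let E = [[1, −1], [−1, 1]] and S = [[a, b], [b, c]] be 2×2 real matrices. If W_x = [[ρ₁, ρ₂], [ρ₃, ρ₄]] ∈ ℝ^{2×2} satisfies κ E W_x S + W_x = I₂, then ρ₁ + ρ₄ − ρ₂ − ρ₃ = ( 2(a + 2b + c)κ + 2 ) / D. -/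
open Matrix

theorem two_by_two_sylvester_closed_form (κ a b c : ℝ)
    (D : ℝ) (hD : D = 4 * (a * c - b ^ 2) * κ ^ 2 + 2 * (a + c) * κ + 1)
    (hDne : D ≠ 0)
    (ρ₁ ρ₂ ρ₃ ρ₄ : ℝ)
    (heq : κ • (!![(1 : ℝ), -1; -1, 1] * !![ρ₁, ρ₂; ρ₃, ρ₄] * !![a, b; b, c]) +
        !![ρ₁, ρ₂; ρ₃, ρ₄] = 1) :
    ρ₁ + ρ₄ - ρ₂ - ρ₃ = (2 * (a + 2 * b + c) * κ + 2) / D := by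
  have h₁₁ := congrFun₂ heq 0 0
  have h₁₂ := congrFun₂ heq 0 1
  have h₂₁ := congrFun₂ heq 1 0
  have h₂₂ := congrFun₂ heq 1 1
  simp at h₁₁ h₁₂ h₂₁ h₂₂
  -- Subtracting rows gives a linear system for `(ρ₁ - ρ₃, ρ₂ - ρ₄)` with determinant `D`.
  rw [eq_div_iff hDne, hD]
  linear_combination (1 + 2 * κ * c + 2 * κ * b) * (h₁₁ - h₂₁) -
    (1 + 2 * κ * a + 2 * κ * b) * (h₁₂ - h₂₂)
end

section
/- Let a, b, c ∈ ℝ satisfy ac − b² ≥ 0, a + c ≥ 0, a + 2b + c ≥ 0, and a − 2b + c ≥ 0. Define f : (0, ∞) → ℝ by f(κ) = ( 2(a + 2b + c)κ + 2 ) / ( 4(ac − b²)κ² + 2(a + c)κ + 1 ). Then the denominator 4(ac − b²)κ² + 2(a + c)κ + 1 is strictly positive for all κ > 0, f(κ) > 0 for all κ > 0, and f is monotonically non-increasing (antitone) on (0, ∞). -/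
theorem closed_form_antitone (a b c : ℝ)
    (h1 : a * c - b ^ 2 ≥ 0) (h2 : a + c ≥ 0)
    (h3 : a + 2 * b + c ≥ 0) (h4 : a - 2 * b + c ≥ 0) :
    (∀ κ : ℝ, 0 < κ →
        0 < 4 * (a * c - b ^ 2) * κ ^ 2 + 2 * (a + c) * κ + 1) ∧
      (∀ κ : ℝ, 0 < κ →
        0 < (2 * (a + 2 * b + c) * κ + 2) /
          (4 * (a * c - b ^ 2) * κ ^ 2 + 2 * (a + c) * κ + 1)) ∧
      AntitoneOn
        (fun κ : ℝ => (2 * (a + 2 * b + c) * κ + 2) /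
          (4 * (a * c - b ^ 2) * κ ^ 2 + 2 * (a + c) * κ + 1))
        (Set.Ioi 0) := by
  have hden : ∀ κ : ℝ, 0 < κ →
      0 < 4 * (a * c - b ^ 2) * κ ^ 2 + 2 * (a + c) * κ + 1 := by
    intro κ hκ
    positivity
  refine ⟨hden, fun κ hκ => div_pos (by positivity) (hden κ hκ), ?_⟩
  intro x hx y hy hxy
  have hx0 : 0 < x := hx
  have hy0 : 0 < y := hy
  have hd : 0 ≤ y - x := sub_nonneg.mpr hxy
  have hkey : 0 ≤ 2 * (y - x) * (4 * (a * c - b ^ 2) * (a + 2 * b + c) * (x * y) +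
      4 * (a * c - b ^ 2) * (x + y) + (a - 2 * b + c)) := by
    positivity
  dsimp only
  rw [div_le_div_iff₀ (hden y hy0) (hden x hx0)]
  linear_combination hkey
end

section
/- Let p₁, p₂ ≥ 0, let W = [[w₁₁, w₁₂], [w₂₁, w₂₂]] ∈ ℝ^{2×2}, and let κ > 0. Define a = p₁p₂(w₁₁² + w₁₂²), b = p₁p₂(w₁₁w₂₁ + w₁₂w₂₂), c = p₁p₂(w₂₁² + w₂₂²). If W_x = [[ρ₁, ρ₂], [ρ₃, ρ₄]] ∈ ℝ^{2×2} satisfies κ [[1, −1], [−1, 1]] W_x [[a, b], [b, c]] + W_x = I₂, then ρ₁ + ρ₄ − ρ₂ − ρ₃ ≥ 0. -/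
open Matrix

theorem order_preserving_quantity_nonneg (p₁ p₂ : ℝ) (hp₁ : 0 ≤ p₁) (hp₂ : 0 ≤ p₂)
    (w₁₁ w₁₂ w₂₁ w₂₂ : ℝ) (κ : ℝ) (hκ : 0 < κ)
    (a b c : ℝ)
    (ha : a = p₁ * p₂ * (w₁₁ ^ 2 + w₁₂ ^ 2))
    (hb : b = p₁ * p₂ * (w₁₁ * w₂₁ + w₁₂ * w₂₂))
    (hc : c = p₁ * p₂ * (w₂₁ ^ 2 + w₂₂ ^ 2))
    (ρ₁ ρ₂ ρ₃ ρ₄ : ℝ)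
    (heq : κ • (!![(1 : ℝ), -1; -1, 1] * !![ρ₁, ρ₂; ρ₃, ρ₄] * !![a, b; b, c]) +
        !![ρ₁, ρ₂; ρ₃, ρ₄] = 1) :
    ρ₁ + ρ₄ - ρ₂ - ρ₃ ≥ 0 := by
  have h₁ := congrFun (congrFun heq 0) 0
  have h₂ := congrFun (congrFun heq 0) 1
  have h₃ := congrFun (congrFun heq 1) 0
  have h₄ := congrFun (congrFun heq 1) 1
  simp at h₁ h₂ h₃ h₄
  -- Pair the difference of the two rows of the equation with the difference of the rows of `W_x`.
  have key : ρ₁ + ρ₄ - ρ₂ - ρ₃ =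
      2 * κ * (p₁ * p₂ * ((w₁₁ * (ρ₁ - ρ₃) + w₂₁ * (ρ₂ - ρ₄)) ^ 2 +
        (w₁₂ * (ρ₁ - ρ₃) + w₂₂ * (ρ₂ - ρ₄)) ^ 2)) + (ρ₁ - ρ₃) ^ 2 + (ρ₂ - ρ₄) ^ 2 := by
    subst ha hb hc
    linear_combination -(ρ₁ - ρ₃) * (h₁ - h₃) - (ρ₂ - ρ₄) * (h₂ - h₄)
  rw [key]
  positivity
end

section
/- Let K ≥ 2 and let W_x ∈ ℝ^{K×K} be symmetric and invertible. For indices i ≠ j, let e_{ij} ∈ ℝ^K be the vector with i-th entry 1, j-th entry −1, and all other entries 0. Suppose that for all i ≠ j, the symmetric matrix e_{ij} e_{ij}ᵀ W_x⁻¹ + W_x⁻¹ e_{ij} e_{ij}ᵀ is positive semidefinite. Then for every z ∈ ℝ^K, setting z′ = W_x z, one has (z′_i − z′_j)(z_i − z_j) ≥ 0 for all i ≠ j; in particular, z_i > z_j implies z′_i ≥ z′_j. -/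
open Matrix

/-- The vector with `i`-th entry `1`, `j`-th entry `-1`, and all other entries `0`. -/
def eVec {K : ℕ} (i j : Fin K) : Fin K → ℝ :=
  fun k => if k = i then 1 else if k = j then -1 else 0

/-- Pairing with `eVec i j` reads off the difference of the `i`-th and `j`-th coordinates. -/
theorem eVec_dotProduct {K : ℕ} {i j : Fin K} (hij : i ≠ j) (x : Fin K → ℝ) :
    eVec i j ⬝ᵥ x = x i - x j := by
  have h : eVec i j = Pi.single i 1 - Pi.single j 1 := by
    funext k
    by_cases hi : k = i
    · subst hi
      simp [eVec, hij]
    · by_cases hj : k = j <;> simp [eVec, hi, hj, hij.symm]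
  simp [h, sub_dotProduct]

/-- For symmetric `A`, the quadratic form of the symmetrized product of `v vᵀ` with `A`. -/
theorem Matrix.IsSymm.dotProduct_vecMulVec_mul_add_mul_vecMulVec_mulVec
    {n R : Type*} [Fintype n] [CommRing R] {A : Matrix n n R} (hA : A.IsSymm) (v x : n → R) :
    x ⬝ᵥ ((vecMulVec v v * A + A * vecMulVec v v) *ᵥ x) =
      2 * ((v ⬝ᵥ x) * (v ⬝ᵥ (A *ᵥ x))) := by
  have h : x ⬝ᵥ (A *ᵥ v) = v ⬝ᵥ (A *ᵥ x) := by
    rw [dotProduct_mulVec, ← mulVec_transpose, hA.eq, dotProduct_comm]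
  simp only [add_mulVec, ← mulVec_mulVec, vecMulVec_mulVec, mulVec_smul, dotProduct_add,
    dotProduct_smul, h, dotProduct_comm x v, op_smul_eq_smul, smul_eq_mul]
  ring

theorem order_preserving_of_psd (K : ℕ) (hK : 2 ≤ K)
    (Wx : Matrix (Fin K) (Fin K) ℝ) (hsymm : Wx.IsSymm) (hWx : IsUnit Wx.det)
    (hpsd : ∀ i j : Fin K, i ≠ j →
      (Matrix.vecMulVec (eVec i j) (eVec i j) * Wx⁻¹ +
        Wx⁻¹ * Matrix.vecMulVec (eVec i j) (eVec i j)).PosSemidef) :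
    ∀ z : Fin K → ℝ, ∀ i j : Fin K, i ≠ j →
      0 ≤ (Wx.mulVec z i - Wx.mulVec z j) * (z i - z j) ∧
        (z j < z i → Wx.mulVec z j ≤ Wx.mulVec z i) := by
  intro z i j hij
  have hcancel : Wx⁻¹ *ᵥ (Wx *ᵥ z) = z := by
    rw [mulVec_mulVec, nonsing_inv_mul _ hWx, one_mulVec]
  have hinv : Wx⁻¹.IsSymm := by
    rw [IsSymm, transpose_nonsing_inv, hsymm.eq]
  have hquad := (hpsd i j hij).dotProduct_mulVec_nonneg (Wx *ᵥ z)
  rw [star_trivial, hinv.dotProduct_vecMulVec_mul_add_mul_vecMulVec_mulVec, hcancel,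
    eVec_dotProduct hij, eVec_dotProduct hij] at hquad
  have hprod : 0 ≤ ((Wx *ᵥ z) i - (Wx *ᵥ z) j) * (z i - z j) := by linarith
  exact ⟨hprod, fun hz => sub_nonneg.mp (nonneg_of_mul_nonneg_left hprod (sub_pos.mpr hz))⟩
end
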